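/- arXiv:1107.4255 — 2 statements merged into one kernel-verified Lean document; each statement's English description precedes it below -/
import Mathlib

section
/- Let A₁ ∈ ℝ^{n₁×n₁}, B₁ ∈ ℝ^{n₁×m}, C₁ ∈ ℝ^{m×n₁}, A₂ ∈ ℝ^{n₂×n₂}, B₂ ∈ ℝ^{n₂×m}, C₂ ∈ ℝ^{m×n₂}, D₂ ∈ ℝ^{m×m}, and let ω > 0 be a real number such that iωI − A₁ and iωI − A₂ are invertible as complex matrices. Set G₁(iω) = C₁(iωI − A₁)⁻¹B₁ and G₂(iω) = C₂(iωI − A₂)⁻¹B₂ + D₂ (real matrices identified with their complex images entrywise). If i(G₁(iω) − G₁(iω)ᴴ) is positive semidefinite and i(G₂(iω) − G₂(iω)ᴴ) is positive definite, then det(I − G₁(iω)·G₂(iω)) ≠ 0. -/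
open Matrix
open scoped ComplexOrder

theorem star_dotProduct_I_smul_sub_conjTranspose_mulVec {n : Type*} [Fintype n]
    (G : Matrix n n ℂ) (x : n → ℂ) :
    star x ⬝ᵥ ((Complex.I • (G - Gᴴ)) *ᵥ x) =
      Complex.I * (star x ⬝ᵥ (G *ᵥ x) - star (G *ᵥ x) ⬝ᵥ x) := by
  rw [smul_mulVec, sub_mulVec, dotProduct_smul, dotProduct_sub, smul_eq_mul, star_mulVec,
    ← dotProduct_mulVec]

/-- A negative imaginary and a strictly negative imaginary matrix have nonsingular
return difference. -/
theorem det_one_sub_mul_ne_zero_of_posSemidef_of_posDef {n : Type*} [Fintype n] [DecidableEq n]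
    {G H : Matrix n n ℂ} (hG : (Complex.I • (G - Gᴴ)).PosSemidef)
    (hH : (Complex.I • (H - Hᴴ)).PosDef) : (1 - G * H).det ≠ 0 := by
  intro h
  obtain ⟨v, hv, hker⟩ := exists_mulVec_eq_zero_iff.mpr h
  have hfix : G *ᵥ (H *ᵥ v) = v := by
    rw [sub_mulVec, one_mulVec, ← mulVec_mulVec, sub_eq_zero] at hker
    exact hker.symm
  have hpos := hH.dotProduct_mulVec_pos hv
  have hnonneg := hG.dotProduct_mulVec_nonneg (H *ᵥ v)
  rw [star_dotProduct_I_smul_sub_conjTranspose_mulVec] at hpos hnonneg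
  rw [hfix] at hnonneg
  refine (add_pos_of_pos_of_nonneg hpos hnonneg).ne' ?_
  ring

theorem det_loop_nonzero_at_frequency {n₁ n₂ m : ℕ}
    (A₁ : Matrix (Fin n₁) (Fin n₁) ℝ) (B₁ : Matrix (Fin n₁) (Fin m) ℝ)
    (C₁ : Matrix (Fin m) (Fin n₁) ℝ)
    (A₂ : Matrix (Fin n₂) (Fin n₂) ℝ) (B₂ : Matrix (Fin n₂) (Fin m) ℝ)
    (C₂ : Matrix (Fin m) (Fin n₂) ℝ) (D₂ : Matrix (Fin m) (Fin m) ℝ)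
    (ω : ℝ) (hω : 0 < ω)
    (h₁ : IsUnit ((Complex.I * (ω : ℂ)) • (1 : Matrix (Fin n₁) (Fin n₁) ℂ)
      - A₁.map Complex.ofReal))
    (h₂ : IsUnit ((Complex.I * (ω : ℂ)) • (1 : Matrix (Fin n₂) (Fin n₂) ℂ)
      - A₂.map Complex.ofReal))
    (hNI : (Complex.I •
      ((C₁.map Complex.ofReal *
          ((Complex.I * (ω : ℂ)) • (1 : Matrix (Fin n₁) (Fin n₁) ℂ)
            - A₁.map Complex.ofReal)⁻¹ * B₁.map Complex.ofReal)
        - (C₁.map Complex.ofReal *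
          ((Complex.I * (ω : ℂ)) • (1 : Matrix (Fin n₁) (Fin n₁) ℂ)
            - A₁.map Complex.ofReal)⁻¹ * B₁.map Complex.ofReal)ᴴ)).PosSemidef)
    (hSNI : (Complex.I •
      ((C₂.map Complex.ofReal *
          ((Complex.I * (ω : ℂ)) • (1 : Matrix (Fin n₂) (Fin n₂) ℂ)
            - A₂.map Complex.ofReal)⁻¹ * B₂.map Complex.ofReal + D₂.map Complex.ofReal)
        - (C₂.map Complex.ofReal *
          ((Complex.I * (ω : ℂ)) • (1 : Matrix (Fin n₂) (Fin n₂) ℂ)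
            - A₂.map Complex.ofReal)⁻¹ * B₂.map Complex.ofReal
          + D₂.map Complex.ofReal)ᴴ)).PosDef) :
    (1 - (C₁.map Complex.ofReal *
        ((Complex.I * (ω : ℂ)) • (1 : Matrix (Fin n₁) (Fin n₁) ℂ)
          - A₁.map Complex.ofReal)⁻¹ * B₁.map Complex.ofReal) *
      (C₂.map Complex.ofReal *
        ((Complex.I * (ω : ℂ)) • (1 : Matrix (Fin n₂) (Fin n₂) ℂ)
          - A₂.map Complex.ofReal)⁻¹ * B₂.map Complex.ofReal
        + D₂.map Complex.ofReal)).det ≠ 0 := by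
  exact det_one_sub_mul_ne_zero_of_posSemidef_of_posDef hNI hSNI
end

section
/- (Main stability theorem.) Let A₁ ∈ ℝ^{n₁×n₁}, B₁ ∈ ℝ^{n₁×m}, C₁ ∈ ℝ^{m×n₁} (a strictly proper system G₁, with D₁ = 0), and A₂ ∈ ℝ^{n₂×n₂}, B₂ ∈ ℝ^{n₂×m}, C₂ ∈ ℝ^{m×n₂}, D₂ = D₂ᵀ ∈ ℝ^{m×m} (a system G₂). Assume: (1) there exist P₁ = P₁ᵀ positive semidefinite, L₁ ∈ ℝ^{m×n₁}, W₁ ∈ ℝ^{m×m} with P₁A₁ + A₁ᵀP₁ = −L₁ᵀL₁, P₁B₁ − A₁ᵀC₁ᵀ = −L₁ᵀW₁, C₁B₁ + B₁ᵀC₁ᵀ = W₁ᵀW₁; (2) there exist P₂ = P₂ᵀ positive definite, L₂ ∈ ℝ^{m×n₂}, W₂ ∈ ℝ^{m×m} with P₂A₂ + A₂ᵀP₂ = −L₂ᵀL₂, P₂B₂ − A₂ᵀC₂ᵀ = −L₂ᵀW₂, C₂B₂ + B₂ᵀC₂ᵀ = W₂ᵀW₂; (3) the pair (A₁, C₁)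 is observable, i.e., for all x ∈ ℝ^{n₁}, if C₁(A₁ᵏx) = 0 for all natural numbers k then x = 0; (4) for every real ω ≠ 0 the complex matrix iωI − A₁ is invertible (so A₁ may have at most an eigenvalue at the origin on the imaginary axis, corresponding to a pole of G₁ at the origin); (5) for every real ω the complex matrix iωI − A₂ is invertible (in particular A₂ is invertible); (6) for every real ω > 0 the matrix i(G₂(iω) − G₂(iω)ᴴ) is positive definite, where G₂(iω) = C₂(iωI − A₂)⁻¹B₂ + D₂; (7) the DC gain Γ = D₂ − C₂A₂⁻¹B₂ is symmetric and negative definite; (8) −C₂A₂⁻¹B₂ − C₂P₂⁻¹C₂ᵀ is positive semidefinite (a property of SNI realizations, i.e., Γ − D₂ ⪰ C₂P₂⁻¹C₂ᵀ); (9) A₁ + B₁ΓC₁ is invertible. Then the closed-loop state matrix Ă = [[A₁ + B₁D₂C₁, B₁C₂], [B₂C₁, A₂]] is Hurwitz: every eigenvalue λ ∈ ℂ of the complexification of Ă satisfies Re(λ) < 0. -/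
open Matrix
open scoped ComplexOrder

section ComplexLemmas

variable {n n₁ n₂ m k : Type*} [Fintype n] [Fintype n₁] [Fintype n₂] [Fintype m] [Fintype k]

/-- The dissipation identity encoded by the negative imaginary LMIs. -/
lemma negativeImaginary_dissipation
    {A P : Matrix n n ℂ} {B : Matrix n m ℂ} {C : Matrix m n ℂ} {L : Matrix k n ℂ}
    {W : Matrix k m ℂ} (hP : Pᴴ = P) (h1 : P * A + Aᴴ * P = -(Lᴴ * L))
    (h2 : P * B - Aᴴ * Cᴴ = -(Lᴴ * W)) (h3 : C * B + Bᴴ * Cᴴ = Wᴴ * W)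
    (x : n → ℂ) (u : m → ℂ) :
    star x ⬝ᵥ (P *ᵥ (A *ᵥ x + B *ᵥ u)) + star (A *ᵥ x + B *ᵥ u) ⬝ᵥ (P *ᵥ x)
      - (star u ⬝ᵥ (C *ᵥ (A *ᵥ x + B *ᵥ u)) + star (C *ᵥ (A *ᵥ x + B *ᵥ u)) ⬝ᵥ u)
      = -(star (L *ᵥ x + W *ᵥ u) ⬝ᵥ (L *ᵥ x + W *ᵥ u)) := by
  have h2' : Bᴴ * P - C * A = -(Wᴴ * L) := by
    simpa [conjTranspose_mul, hP] using congrArg conjTranspose h2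
  have e1 := congrArg (fun M => star x ⬝ᵥ (M *ᵥ x)) h1
  have e2 := congrArg (fun M => star x ⬝ᵥ (M *ᵥ u)) h2
  have e2' := congrArg (fun M => star u ⬝ᵥ (M *ᵥ x)) h2'
  have e3 := congrArg (fun M => star u ⬝ᵥ (M *ᵥ u)) h3
  simp only [add_mulVec, sub_mulVec, neg_mulVec, dotProduct_add, dotProduct_sub, dotProduct_neg]
    at e1 e2 e2' e3
  simp only [mulVec_add, star_add, star_mulVec, dotProduct_add, add_dotProduct,
    ← dotProduct_mulVec, mulVec_mulVec, conjTranspose_mul]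
  linear_combination e1 + e2 + e2' - e3

/-- Positivity of the storage function of the positive-feedback interconnection. -/
lemma interconnection_storage_pos [DecidableEq n₂]
    {P₁ : Matrix n₁ n₁ ℂ} {C₁ : Matrix m n₁ ℂ} {P₂ Q : Matrix n₂ n₂ ℂ} {C₂ : Matrix m n₂ ℂ}
    {D : Matrix m m ℂ} (hP₁ : P₁.PosSemidef) (hP₂ : P₂.PosDef) (hQ : P₂ * Q = 1)
    (hN : (-(D + C₂ * Q * C₂ᴴ)).PosDef)
    (hobs : ∀ x, P₁ *ᵥ x = 0 → C₁ *ᵥ x = 0 → x = 0)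
    (x₁ : n₁ → ℂ) (x₂ : n₂ → ℂ) (hx : x₁ ≠ 0 ∨ x₂ ≠ 0) :
    0 < star x₁ ⬝ᵥ (P₁ *ᵥ x₁) + star x₂ ⬝ᵥ (P₂ *ᵥ x₂)
      - (star (C₁ *ᵥ x₁) ⬝ᵥ (C₂ *ᵥ x₂) + star (C₂ *ᵥ x₂) ⬝ᵥ (C₁ *ᵥ x₁)
        + star (C₁ *ᵥ x₁) ⬝ᵥ (D *ᵥ (C₁ *ᵥ x₁))) := by
  have hQ' : Qᴴ * P₂ = 1 := by
    simpa [conjTranspose_mul, hP₂.isHermitian.eq] using congrArg conjTranspose hQ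
  have key : ∀ w : m → ℂ, star x₂ ⬝ᵥ (P₂ *ᵥ x₂)
      - (star w ⬝ᵥ (C₂ *ᵥ x₂) + star (C₂ *ᵥ x₂) ⬝ᵥ w + star w ⬝ᵥ (D *ᵥ w))
      = star (x₂ - Q *ᵥ (C₂ᴴ *ᵥ w)) ⬝ᵥ (P₂ *ᵥ (x₂ - Q *ᵥ (C₂ᴴ *ᵥ w)))
        + star w ⬝ᵥ ((-(D + C₂ * Q * C₂ᴴ)) *ᵥ w) := by
    intro w
    have r1 : P₂ *ᵥ (x₂ - Q *ᵥ (C₂ᴴ *ᵥ w)) = P₂ *ᵥ x₂ - C₂ᴴ *ᵥ w := by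
      rw [mulVec_sub, mulVec_mulVec _ P₂ Q, hQ, one_mulVec]
    have r2 : star (Q *ᵥ (C₂ᴴ *ᵥ w)) ⬝ᵥ (P₂ *ᵥ x₂) = star w ⬝ᵥ (C₂ *ᵥ x₂) := by
      rw [star_mulVec, star_mulVec, conjTranspose_conjTranspose, ← dotProduct_mulVec,
        mulVec_mulVec, hQ', one_mulVec, ← dotProduct_mulVec]
    have r3 : star (Q *ᵥ (C₂ᴴ *ᵥ w)) ⬝ᵥ (C₂ᴴ *ᵥ w) = star w ⬝ᵥ ((C₂ * Q * C₂ᴴ) *ᵥ w) := by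
      have hQQ : Qᴴ = Q := by
        calc Qᴴ = Qᴴ * (P₂ * Q) := by rw [hQ, Matrix.mul_one]
          _ = Q := by rw [← Matrix.mul_assoc, hQ', Matrix.one_mul]
      rw [star_mulVec, star_mulVec, conjTranspose_conjTranspose, hQQ]
      simp only [← dotProduct_mulVec, mulVec_mulVec, Matrix.mul_assoc, vecMul_vecMul]
    rw [r1, star_sub, sub_dotProduct, dotProduct_sub, dotProduct_sub, r2, r3, star_mulVec C₂,
      ← dotProduct_mulVec, neg_mulVec, add_mulVec, dotProduct_neg, dotProduct_add]
    ring
  rw [add_sub_assoc, key]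
  have t1 := hP₁.dotProduct_mulVec_nonneg x₁
  have t2 := hP₂.posSemidef.dotProduct_mulVec_nonneg (x₂ - Q *ᵥ (C₂ᴴ *ᵥ (C₁ *ᵥ x₁)))
  have t3 := hN.posSemidef.dotProduct_mulVec_nonneg (C₁ *ᵥ x₁)
  by_cases hw : C₁ *ᵥ x₁ = 0
  · by_cases hx₁ : x₁ = 0
    · have hx₂ : x₂ ≠ 0 := by simpa [hx₁] using hx
      simpa [hw, hx₁] using hP₂.dotProduct_mulVec_pos hx₂
    · have hne : star x₁ ⬝ᵥ (P₁ *ᵥ x₁) ≠ 0 := fun h =>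
        hx₁ (hobs x₁ ((hP₁.dotProduct_mulVec_zero_iff x₁).1 h) hw)
      exact add_pos_of_pos_of_nonneg (lt_of_le_of_ne t1 hne.symm) (add_nonneg t2 t3)
  · exact add_pos_of_nonneg_of_pos t1
      (add_pos_of_nonneg_of_pos t2 (hN.dotProduct_mulVec_pos hw))

/-- On the imaginary axis, equality in the dissipation inequality forces a zero input of a
strictly negative imaginary system. -/
lemma strictlyNegativeImaginary_input_eq_zero [DecidableEq n]
    {A : Matrix n n ℂ} {B : Matrix n m ℂ} {C : Matrix m n ℂ} {D : Matrix m m ℂ} (hD : Dᴴ = D)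
    {ω : ℝ} (hω : ω ≠ 0)
    (hA : IsUnit ((Complex.I * (ω : ℂ)) • (1 : Matrix n n ℂ) - A))
    (hG : (Complex.I •
      ((C * ((Complex.I * (ω : ℂ)) • (1 : Matrix n n ℂ) - A)⁻¹ * B + D)
        - (C * ((Complex.I * (ω : ℂ)) • (1 : Matrix n n ℂ) - A)⁻¹ * B + D)ᴴ)).PosDef)
    {x : n → ℂ} {u : m → ℂ} (hx : A *ᵥ x + B *ᵥ u = (Complex.I * (ω : ℂ)) • x)
    (hdis : star u ⬝ᵥ (C *ᵥ ((Complex.I * (ω : ℂ)) • x))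
      + star (C *ᵥ ((Complex.I * (ω : ℂ)) • x)) ⬝ᵥ u = 0) :
    u = 0 := by
  set S := (Complex.I * (ω : ℂ)) • (1 : Matrix n n ℂ) - A with hS
  set G := C * S⁻¹ * B + D with hGdef
  have hSx : S *ᵥ x = B *ᵥ u := by
    rw [hS, sub_mulVec, smul_mulVec, one_mulVec, ← hx, add_sub_cancel_left]
  have hxs : S⁻¹ *ᵥ (B *ᵥ u) = x := by
    rw [← hSx, mulVec_mulVec, nonsing_inv_mul _ ((isUnit_iff_isUnit_det _).1 hA), one_mulVec]
  have hGu : G *ᵥ u = C *ᵥ x + D *ᵥ u := by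
    rw [hGdef, add_mulVec, ← hxs]
    simp only [mulVec_mulVec, Matrix.mul_assoc]
  have hGu' : star u ⬝ᵥ (Gᴴ *ᵥ u) = star (C *ᵥ x) ⬝ᵥ u + star u ⬝ᵥ (D *ᵥ u) := by
    rw [dotProduct_mulVec, ← star_mulVec, hGu, star_add, add_dotProduct, star_mulVec D, hD,
      ← dotProduct_mulVec]
  by_contra hu
  have hpos := hG.dotProduct_mulVec_pos hu
  rw [smul_mulVec, sub_mulVec, dotProduct_smul, dotProduct_sub, hGu, hGu', dotProduct_add] at hpos
  simp only [mulVec_smul, dotProduct_smul, star_smul, smul_dotProduct, smul_eq_mul, star_mul',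
    Complex.star_def, Complex.conj_I, Complex.conj_ofReal] at hdis hpos
  have hω' : (ω : ℂ) ≠ 0 := by exact_mod_cast hω
  refine hpos.ne' (mul_left_cancel₀ hω' ?_)
  linear_combination hdis

lemma eigenvector_eq_zero_of_isUnit [DecidableEq n] {A : Matrix n n ℂ} {c : ℂ}
    (hA : IsUnit (c • (1 : Matrix n n ℂ) - A)) {x : n → ℂ} (hx : A *ᵥ x = c • x) : x = 0 := by
  apply mulVec_injective_of_isUnit hA
  rw [mulVec_zero, sub_mulVec, smul_mulVec, one_mulVec, hx, sub_self]

/-- An eigenvalue in the closed upper half plane of the positive-feedback interconnection of a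
negative imaginary and a strictly negative imaginary system has negative real part. -/
lemma interconnection_eigenvalue_re_neg [DecidableEq n₁] [DecidableEq n₂]
    {A₁ P₁ : Matrix n₁ n₁ ℂ} {B₁ : Matrix n₁ m ℂ} {C₁ : Matrix m n₁ ℂ} {L₁ : Matrix k n₁ ℂ}
    {W₁ : Matrix k m ℂ} {A₂ P₂ Q R : Matrix n₂ n₂ ℂ} {B₂ : Matrix n₂ m ℂ} {C₂ : Matrix m n₂ ℂ}
    {L₂ : Matrix k n₂ ℂ} {W₂ : Matrix k m ℂ} {D : Matrix m m ℂ} (hD : Dᴴ = D)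
    (hP₁ : P₁.PosSemidef) (h11 : P₁ * A₁ + A₁ᴴ * P₁ = -(L₁ᴴ * L₁))
    (h12 : P₁ * B₁ - A₁ᴴ * C₁ᴴ = -(L₁ᴴ * W₁)) (h13 : C₁ * B₁ + B₁ᴴ * C₁ᴴ = W₁ᴴ * W₁)
    (hP₂ : P₂.PosDef) (h21 : P₂ * A₂ + A₂ᴴ * P₂ = -(L₂ᴴ * L₂))
    (h22 : P₂ * B₂ - A₂ᴴ * C₂ᴴ = -(L₂ᴴ * W₂)) (h23 : C₂ * B₂ + B₂ᴴ * C₂ᴴ = W₂ᴴ * W₂)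
    (hQ : P₂ * Q = 1) (hR : R * A₂ = 1)
    (hobs : ∀ x, P₁ *ᵥ x = 0 → C₁ *ᵥ x = 0 → x = 0)
    (hA₁ : ∀ ω : ℝ, 0 < ω → IsUnit ((Complex.I * (ω : ℂ)) • (1 : Matrix n₁ n₁ ℂ) - A₁))
    (hA₂ : ∀ ω : ℝ, 0 < ω → IsUnit ((Complex.I * (ω : ℂ)) • (1 : Matrix n₂ n₂ ℂ) - A₂))
    (hG : ∀ ω : ℝ, 0 < ω → (Complex.I •
      ((C₂ * ((Complex.I * (ω : ℂ)) • (1 : Matrix n₂ n₂ ℂ) - A₂)⁻¹ * B₂ + D)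
        - (C₂ * ((Complex.I * (ω : ℂ)) • (1 : Matrix n₂ n₂ ℂ) - A₂)⁻¹ * B₂ + D)ᴴ)).PosDef)
    (hN : (-(D + C₂ * Q * C₂ᴴ)).PosDef)
    (hnonsing : IsUnit (A₁ + B₁ * (D - C₂ * R * B₂) * C₁))
    {lam : ℂ} (him : 0 ≤ lam.im) {x₁ : n₁ → ℂ} {x₂ : n₂ → ℂ} (hx : x₁ ≠ 0 ∨ x₂ ≠ 0)
    (hx₁ : A₁ *ᵥ x₁ + B₁ *ᵥ (D *ᵥ (C₁ *ᵥ x₁) + C₂ *ᵥ x₂) = lam • x₁)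
    (hx₂ : A₂ *ᵥ x₂ + B₂ *ᵥ (C₁ *ᵥ x₁) = lam • x₂) :
    lam.re < 0 := by
  have hV := interconnection_storage_pos hP₁ hP₂ hQ hN hobs x₁ x₂ hx
  have d1 := negativeImaginary_dissipation hP₁.isHermitian.eq h11 h12 h13 x₁
    (D *ᵥ (C₁ *ᵥ x₁) + C₂ *ᵥ x₂)
  have d2 := negativeImaginary_dissipation hP₂.isHermitian.eq h21 h22 h23 x₂ (C₁ *ᵥ x₁)
  rw [hx₁] at d1
  rw [hx₂] at d2
  set q₁ := star (L₁ *ᵥ x₁ + W₁ *ᵥ (D *ᵥ (C₁ *ᵥ x₁) + C₂ *ᵥ x₂)) ⬝ᵥ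
    (L₁ *ᵥ x₁ + W₁ *ᵥ (D *ᵥ (C₁ *ᵥ x₁) + C₂ *ᵥ x₂))
  set q₂ := star (L₂ *ᵥ x₂ + W₂ *ᵥ (C₁ *ᵥ x₁)) ⬝ᵥ (L₂ *ᵥ x₂ + W₂ *ᵥ (C₁ *ᵥ x₁))
  have hq₁0 : 0 ≤ q₁ := dotProduct_star_self_nonneg _
  have hq₂0 : 0 ≤ q₂ := dotProduct_star_self_nonneg _
  set V := star x₁ ⬝ᵥ (P₁ *ᵥ x₁) + star x₂ ⬝ᵥ (P₂ *ᵥ x₂)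
      - (star (C₁ *ᵥ x₁) ⬝ᵥ (C₂ *ᵥ x₂) + star (C₂ *ᵥ x₂) ⬝ᵥ (C₁ *ᵥ x₁)
        + star (C₁ *ᵥ x₁) ⬝ᵥ (D *ᵥ (C₁ *ᵥ x₁))) with hVdef
  have hDw : star (D *ᵥ (C₁ *ᵥ x₁)) ⬝ᵥ (C₁ *ᵥ x₁) = star (C₁ *ᵥ x₁) ⬝ᵥ (D *ᵥ (C₁ *ᵥ x₁)) := by
    rw [star_mulVec D, hD, ← dotProduct_mulVec]
  have hsum : (lam + star lam) * V = -(q₁ + q₂) := by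
    have e1 := d1
    have e2 := d2
    simp only [mulVec_smul, dotProduct_smul, star_smul, smul_dotProduct, smul_eq_mul, star_add,
      add_dotProduct, dotProduct_add, hDw] at e1 e2
    rw [hVdef]
    linear_combination e1 + e2
  have hre : 2 * lam.re * V.re = -(q₁.re + q₂.re) := by
    have := congrArg Complex.re hsum
    have hc : lam + star lam = ((2 * lam.re : ℝ) : ℂ) := Complex.add_conj lam
    rwa [hc, Complex.re_ofReal_mul, Complex.neg_re, Complex.add_re] at this
  have hVre : 0 < V.re := (Complex.pos_iff.1 hV).1
  have hq₁re : 0 ≤ q₁.re := (Complex.nonneg_iff.1 hq₁0).1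
  have hq₂re : 0 ≤ q₂.re := (Complex.nonneg_iff.1 hq₂0).1
  by_contra hneg
  push Not at hneg
  have hlam : lam.re = 0 := by nlinarith [mul_nonneg hneg hVre.le]
  have hq₂z : q₂ = 0 := by
    apply Complex.ext
    · rw [hlam] at hre
      simp only [Complex.zero_re]
      linarith
    · exact (Complex.nonneg_iff.1 hq₂0).2.symm
  have hlamI : lam = Complex.I * (lam.im : ℂ) := by
    apply Complex.ext <;> simp [hlam]
  rcases him.eq_or_lt with h0 | hpos
  · have hl0 : lam = 0 := by rw [hlamI, ← h0]; simp
    rw [hl0, zero_smul] at hx₁ hx₂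
    have hx₂R : x₂ = -(R *ᵥ (B₂ *ᵥ (C₁ *ᵥ x₁))) := by
      have := congrArg (R *ᵥ ·) hx₂
      simp only [mulVec_add, mulVec_zero] at this
      rw [mulVec_mulVec, hR, one_mulVec] at this
      exact eq_neg_of_add_eq_zero_left this
    have hz : (A₁ + B₁ * (D - C₂ * R * B₂) * C₁) *ᵥ x₁ = 0 := by
      rw [← hx₁, hx₂R]
      simp only [mulVec_add, mulVec_neg, mulVec_mulVec, add_mulVec, Matrix.mul_sub,
        Matrix.sub_mul, Matrix.mul_assoc, sub_mulVec]
      abel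
    have hx₁z : x₁ = 0 := by
      have := mulVec_injective_of_isUnit hnonsing
      exact this (by rw [hz, mulVec_zero])
    have hx₂z : x₂ = 0 := by rw [hx₂R, hx₁z]; simp
    simp [hx₁z, hx₂z] at hx
  · have hdis : star (C₁ *ᵥ x₁) ⬝ᵥ (C₂ *ᵥ ((Complex.I * (lam.im : ℂ)) • x₂))
        + star (C₂ *ᵥ ((Complex.I * (lam.im : ℂ)) • x₂)) ⬝ᵥ (C₁ *ᵥ x₁) = 0 := by
      rw [← hlamI]
      have hc : lam + star lam = 0 := by
        have : lam + star lam = ((2 * lam.re : ℝ) : ℂ) := Complex.add_conj lam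
        rw [this, hlam]; simp
      have e2 := d2
      rw [mulVec_smul P₂, dotProduct_smul, star_smul lam x₂, smul_dotProduct, hq₂z] at e2
      simp only [smul_eq_mul] at e2
      linear_combination -e2 + (star x₂ ⬝ᵥ (P₂ *ᵥ x₂)) * hc
    have hw : C₁ *ᵥ x₁ = 0 := strictlyNegativeImaginary_input_eq_zero hD hpos.ne'
      (hA₂ _ hpos) (hG _ hpos) (by rw [hx₂, ← hlamI]) hdis
    have hx₂z : x₂ = 0 := eigenvector_eq_zero_of_isUnit (hA₂ _ hpos) (by
      simpa [hw, ← hlamI] using hx₂)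
    have hx₁z : x₁ = 0 := eigenvector_eq_zero_of_isUnit (hA₁ _ hpos) (by
      simpa [hw, hx₂z, ← hlamI] using hx₁)
    simp [hx₁z, hx₂z] at hx

end ComplexLemmas

section Complexification

variable {l n m : Type*}

lemma conjTranspose_map_ofReal (M : Matrix m n ℝ) :
    (M.map Complex.ofReal)ᴴ = Mᵀ.map Complex.ofReal := by
  ext i j
  simp

lemma map_ofReal_mul [Fintype m] (M : Matrix l m ℝ) (N : Matrix m n ℝ) :
    (M * N).map Complex.ofReal = M.map Complex.ofReal * N.map Complex.ofReal :=
  Matrix.map_mul (f := Complex.ofRealHom)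

lemma map_ofReal_add (M N : Matrix m n ℝ) :
    (M + N).map Complex.ofReal = M.map Complex.ofReal + N.map Complex.ofReal := by
  ext; simp

lemma map_ofReal_sub (M N : Matrix m n ℝ) :
    (M - N).map Complex.ofReal = M.map Complex.ofReal - N.map Complex.ofReal := by
  ext; simp

lemma map_ofReal_neg (M : Matrix m n ℝ) :
    (-M).map Complex.ofReal = -M.map Complex.ofReal := by
  ext; simp

lemma map_ofReal_one [DecidableEq n] :
    (1 : Matrix n n ℝ).map Complex.ofReal = 1 :=
  Matrix.map_one _ Complex.ofReal_zero Complex.ofReal_one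

variable [Fintype n]

lemma isUnit_map_ofReal_iff [DecidableEq n] {M : Matrix n n ℝ} :
    IsUnit (M.map Complex.ofReal) ↔ IsUnit M := by
  have h : (M.map Complex.ofReal).det = (M.det : ℂ) := (Complex.ofRealHom.map_det M).symm
  rw [isUnit_iff_isUnit_det, isUnit_iff_isUnit_det, h, isUnit_iff_ne_zero, isUnit_iff_ne_zero,
    Complex.ofReal_ne_zero]

lemma posSemidef_map_ofReal {M : Matrix n n ℝ} (hM : M.PosSemidef) :
    (M.map Complex.ofReal).PosSemidef := by
  classical
  open scoped MatrixOrder in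
  obtain ⟨B, rfl⟩ := CStarAlgebra.nonneg_iff_eq_star_mul_self.mp hM.nonneg
  rw [map_ofReal_mul, star_eq_conjTranspose, conjTranspose_eq_transpose_of_trivial,
    ← conjTranspose_map_ofReal]
  exact posSemidef_conjTranspose_mul_self _

lemma posDef_map_ofReal {M : Matrix n n ℝ} (hM : M.PosDef) :
    (M.map Complex.ofReal).PosDef := by
  classical
  exact (posSemidef_map_ofReal hM.posSemidef).posDef_iff_isUnit.2
    (isUnit_map_ofReal_iff.2 hM.isUnit)

lemma map_ofReal_mulVec_star (M : Matrix m n ℝ) (v : n → ℂ) :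
    M.map Complex.ofReal *ᵥ star v = star (M.map Complex.ofReal *ᵥ v) := by
  ext i
  simp [mulVec, dotProduct]

lemma re_map_ofReal_mulVec (M : Matrix m n ℝ) (v : n → ℂ) :
    (fun i => ((M.map Complex.ofReal *ᵥ v) i).re) = M *ᵥ fun i => (v i).re := by
  ext i
  simp [mulVec, dotProduct]

lemma im_map_ofReal_mulVec (M : Matrix m n ℝ) (v : n → ℂ) :
    (fun i => ((M.map Complex.ofReal *ᵥ v) i).im) = M *ᵥ fun i => (v i).im := by
  ext i
  simp [mulVec, dotProduct]

end Complexification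

/-- For an observable negative imaginary realization, the certificate and the output matrix have
no common kernel. -/
lemma eq_zero_of_certificate_mulVec_eq_zero {n m k : Type*} [Fintype n] [DecidableEq n]
    [Fintype m] [Fintype k] {A P : Matrix n n ℝ} {B : Matrix n m ℝ} {C : Matrix m n ℝ}
    {L : Matrix k n ℝ} {W : Matrix k m ℝ} (hP : Pᵀ = P) (h1 : P * A + Aᵀ * P = -(Lᵀ * L))
    (h2 : P * B - Aᵀ * Cᵀ = -(Lᵀ * W))
    (hobs : ∀ x : n → ℝ, (∀ j : ℕ, C *ᵥ ((A ^ j) *ᵥ x) = 0) → x = 0)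
    (x : n → ℝ) (hPx : P *ᵥ x = 0) (hCx : C *ᵥ x = 0) : x = 0 := by
  have h2' : Bᵀ * P - C * A = -(Wᵀ * L) := by
    simpa [transpose_mul, hP] using congrArg transpose h2
  have step : ∀ y : n → ℝ, P *ᵥ y = 0 → P *ᵥ (A *ᵥ y) = 0 ∧ C *ᵥ (A *ᵥ y) = 0 := by
    intro y hy
    have e1 := congrArg (· *ᵥ y) h1
    have e2 := congrArg (· *ᵥ y) h2'
    simp only [add_mulVec, sub_mulVec, neg_mulVec, ← mulVec_mulVec, hy, mulVec_zero, add_zero,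
      zero_sub] at e1 e2
    have hL : L *ᵥ y = 0 := by
      have e3 := congrArg (y ⬝ᵥ ·) e1
      simp only [dotProduct_neg] at e3
      rw [dotProduct_mulVec y P, ← mulVec_transpose, hP, hy, zero_dotProduct,
        dotProduct_mulVec y Lᵀ, vecMul_transpose] at e3
      exact dotProduct_self_eq_zero.1 (neg_eq_zero.1 e3.symm)
    rw [hL, mulVec_zero] at e1 e2
    exact ⟨by simpa using e1, by simpa using e2⟩
  have hpow : ∀ j : ℕ, P *ᵥ ((A ^ j) *ᵥ x) = 0 ∧ C *ᵥ ((A ^ j) *ᵥ x) = 0 := by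
    intro j
    induction j with
    | zero => simpa using ⟨hPx, hCx⟩
    | succ j ih =>
      rw [pow_succ', ← mulVec_mulVec]
      exact step _ ih.1
  exact hobs x fun j => (hpow j).2

theorem ni_sni_interconnection_internally_stable {n₁ n₂ m : ℕ}
    (A₁ : Matrix (Fin n₁) (Fin n₁) ℝ) (B₁ : Matrix (Fin n₁) (Fin m) ℝ)
    (C₁ : Matrix (Fin m) (Fin n₁) ℝ)
    (A₂ : Matrix (Fin n₂) (Fin n₂) ℝ) (B₂ : Matrix (Fin n₂) (Fin m) ℝ)
    (C₂ : Matrix (Fin m) (Fin n₂) ℝ) (D₂ : Matrix (Fin m) (Fin m) ℝ)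
    (hD₂ : D₂ᵀ = D₂)
    -- (1) NI LMI certificate for G₁
    (P₁ : Matrix (Fin n₁) (Fin n₁) ℝ) (L₁ : Matrix (Fin m) (Fin n₁) ℝ)
    (W₁ : Matrix (Fin m) (Fin m) ℝ)
    (hP₁symm : P₁ᵀ = P₁) (hP₁psd : P₁.PosSemidef)
    (h11 : P₁ * A₁ + A₁ᵀ * P₁ = -(L₁ᵀ * L₁))
    (h12 : P₁ * B₁ - A₁ᵀ * C₁ᵀ = -(L₁ᵀ * W₁))
    (h13 : C₁ * B₁ + B₁ᵀ * C₁ᵀ = W₁ᵀ * W₁)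
    -- (2) SNI LMI certificate for G₂
    (P₂ : Matrix (Fin n₂) (Fin n₂) ℝ) (L₂ : Matrix (Fin m) (Fin n₂) ℝ)
    (W₂ : Matrix (Fin m) (Fin m) ℝ)
    (hP₂symm : P₂ᵀ = P₂) (hP₂pd : P₂.PosDef)
    (h21 : P₂ * A₂ + A₂ᵀ * P₂ = -(L₂ᵀ * L₂))
    (h22 : P₂ * B₂ - A₂ᵀ * C₂ᵀ = -(L₂ᵀ * W₂))
    (h23 : C₂ * B₂ + B₂ᵀ * C₂ᵀ = W₂ᵀ * W₂)
    -- (3) observability of (A₁, C₁)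
    (hobs : ∀ x : Fin n₁ → ℝ, (∀ k : ℕ, C₁.mulVec ((A₁ ^ k).mulVec x) = 0) → x = 0)
    -- (4) A₁ has no nonzero imaginary-axis eigenvalues
    (hA₁ : ∀ ω : ℝ, ω ≠ 0 →
      IsUnit ((Complex.I * (ω : ℂ)) • (1 : Matrix (Fin n₁) (Fin n₁) ℂ)
        - A₁.map Complex.ofReal))
    -- (5) A₂ has no imaginary-axis eigenvalues
    (hA₂ : ∀ ω : ℝ,
      IsUnit ((Complex.I * (ω : ℂ)) • (1 : Matrix (Fin n₂) (Fin n₂) ℂ)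
        - A₂.map Complex.ofReal))
    -- (6) SNI frequency condition on G₂
    (hSNI : ∀ ω : ℝ, 0 < ω →
      (Complex.I •
        ((C₂.map Complex.ofReal *
            ((Complex.I * (ω : ℂ)) • (1 : Matrix (Fin n₂) (Fin n₂) ℂ)
              - A₂.map Complex.ofReal)⁻¹ * B₂.map Complex.ofReal
            + D₂.map Complex.ofReal)
          - (C₂.map Complex.ofReal *
            ((Complex.I * (ω : ℂ)) • (1 : Matrix (Fin n₂) (Fin n₂) ℂ)
              - A₂.map Complex.ofReal)⁻¹ * B₂.map Complex.ofReal
            + D₂.map Complex.ofReal)ᴴ)).PosDef)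
    -- (7) DC gain condition G₂(0) < 0
    (hΓsymm : (D₂ - C₂ * A₂⁻¹ * B₂)ᵀ = D₂ - C₂ * A₂⁻¹ * B₂)
    (hΓnegdef : (-(D₂ - C₂ * A₂⁻¹ * B₂)).PosDef)
    -- (8) SNI realization property: Γ − D₂ ⪰ C₂ P₂⁻¹ C₂ᵀ
    (hreal : (-(C₂ * A₂⁻¹ * B₂) - C₂ * P₂⁻¹ * C₂ᵀ).PosSemidef)
    -- (9) nonsingularity of A₁ + B₁ G₂(0) C₁
    (hnonsing : IsUnit (A₁ + B₁ * (D₂ - C₂ * A₂⁻¹ * B₂) * C₁)) :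
    -- conclusion: the closed-loop state matrix is Hurwitz
    ∀ lam : ℂ, lam ∈ spectrum ℂ
        ((Matrix.fromBlocks (A₁ + B₁ * D₂ * C₁) (B₁ * C₂) (B₂ * C₁) A₂).map
          Complex.ofReal) →
      lam.re < 0 := by
  have hA₂unit : IsUnit A₂ := by
    have h := (hA₂ 0).neg
    simpa [isUnit_map_ofReal_iff] using h
  have hobs' : ∀ x : Fin n₁ → ℂ, P₁.map Complex.ofReal *ᵥ x = 0 →
      C₁.map Complex.ofReal *ᵥ x = 0 → x = 0 := by
    intro x hPx hCx
    have hker := eq_zero_of_certificate_mulVec_eq_zero hP₁symm h11 h12 hobs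
    have hr := hker (fun i => (x i).re) (by rw [← re_map_ofReal_mulVec, hPx]; rfl)
      (by rw [← re_map_ofReal_mulVec, hCx]; rfl)
    have hi := hker (fun i => (x i).im) (by rw [← im_map_ofReal_mulVec, hPx]; rfl)
      (by rw [← im_map_ofReal_mulVec, hCx]; rfl)
    ext i
    exact Complex.ext (congrFun hr i) (congrFun hi i)
  have hN : (-(D₂ + C₂ * P₂⁻¹ * C₂ᵀ)).PosDef := by
    have := hΓnegdef.add_posSemidef hreal
    convert this using 1
    abel
  have hQ : P₂ * P₂⁻¹ = 1 := mul_nonsing_inv _ ((isUnit_iff_isUnit_det _).1 hP₂pd.isUnit)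
  have hR : A₂⁻¹ * A₂ = 1 := nonsing_inv_mul _ ((isUnit_iff_isUnit_det _).1 hA₂unit)
  have key : ∀ lam : ℂ, 0 ≤ lam.im → ∀ v : Fin n₁ ⊕ Fin n₂ → ℂ, v ≠ 0 →
      (fromBlocks (A₁ + B₁ * D₂ * C₁) (B₁ * C₂) (B₂ * C₁) A₂).map Complex.ofReal *ᵥ v = lam • v →
      lam.re < 0 := by
    intro lam him v hv hev
    have hv' : v ∘ Sum.inl ≠ 0 ∨ v ∘ Sum.inr ≠ 0 := by
      by_contra! h
      apply hv
      rw [← Sum.elim_comp_inl_inr v, h.1, h.2]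
      simp
    rw [fromBlocks_map, fromBlocks_mulVec] at hev
    have hev₁ := congrArg (· ∘ Sum.inl) hev
    have hev₂ := congrArg (· ∘ Sum.inr) hev
    simp only [Sum.elim_comp_inl, Sum.elim_comp_inr] at hev₁ hev₂
    have complexify {a b : Type} {M N : Matrix a b ℝ} (h : M = N) :
        M.map Complex.ofReal = N.map Complex.ofReal := congrArg (·.map Complex.ofReal) h
    have c11 := complexify h11
    have c12 := complexify h12
    have c13 := complexify h13
    have c21 := complexify h21
    have c22 := complexify h22
    have c23 := complexify h23
    have cQ := complexify hQ
    have cR := complexify hR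
    have cD := complexify hD₂
    have cN := posDef_map_ofReal hN
    have cns := isUnit_map_ofReal_iff.2 hnonsing
    simp only [map_ofReal_add, map_ofReal_sub, map_ofReal_neg, map_ofReal_mul, map_ofReal_one,
      ← conjTranspose_map_ofReal] at c11 c12 c13 c21 c22 c23 cQ cR cD cN cns hev₁ hev₂
    refine interconnection_eigenvalue_re_neg cD (posSemidef_map_ofReal hP₁psd) c11 c12 c13
      (posDef_map_ofReal hP₂pd) c21 c22 c23 cQ cR hobs' (fun ω hω => hA₁ ω hω.ne')
      (fun ω _ => hA₂ ω) hSNI cN cns him hv' ?_ ?_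
    · refine Eq.trans ?_ hev₁
      simp only [add_mulVec, mulVec_add, mulVec_mulVec, Matrix.mul_assoc, add_assoc]
    · refine Eq.trans ?_ hev₂
      rw [mulVec_mulVec, add_comm]
  intro lam hlam
  rw [← spectrum_toLin', ← Module.End.hasEigenvalue_iff_mem_spectrum] at hlam
  obtain ⟨v, hv⟩ := hlam.exists_hasEigenvector
  have hev := hv.apply_eq_smul
  rw [toLin'_apply] at hev
  rcases le_total 0 lam.im with him | him
  · exact key lam him v hv.2 hev
  · have := key (star lam) (by simpa using him) (star v) (star_ne_zero.2 hv.2) (by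
      rw [map_ofReal_mulVec_star, hev, star_smul])
    simpa using this
end
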